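/- Let 0 < q < 1, let N ∈ ℕ, let a, c > 0 and b, d ∈ ℂ with a·b·c·d·q^j ≠ 1 for all 0 ≤ j < N; set θ = 1/√(1−q). Suppose G : ℕ → (ℂ → ℂ) satisfies G_0(t) = 1 for all t and, for all 0 ≤ n < N and all t ∈ ℂ (with the convention G_{−1} = 0): (1 − abcd·q^n)·G_{n+1}(t) = θ·[(a+b)(1 − t·cd)·G_n(q·t) + (c+d)(t − q^n·ab)·G_n(t)] − θ²·(1 − q^n)·[ab·(1 − t·cd)·G_{n−1}(q·t) + t·cd·(t − ab·q^n)·G_{n−1}(t)]. For parameters (a′,b′,c′,d′) ∈ ℂ⁴ with a′ ≠ 0 and (a′b′c′d′;q)_j having no vanishing factors for j ≤ n, define A_n(a′,b′,c′,d′) = θ^n·Σ_{k=0}^{n} c_{n,k}(a′,b′)·(a′b′;q)_k·(a′)^{−k}·Σ_{j=0}^{k} q^j·(q^{−k};q)_j·(a′d′;q)_j·(a′c′;q)_j/((q;q)_j·(a′b′c′d′;q)_j), where c_{n,k}(a′,b′) = Σ_{ℓ=k}^{n} binom_q(n,ℓ)·binom_q(ℓ,k)·(a′)^{n−ℓ}·(b′)^{ℓ−k}.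 Then for every 0 ≤ n < N and every t ∈ ℂ with t ≠ 0: t^n·G_n(1/t²) = A_n(a·t, b·t, c/t, d/t). -/

import Mathlib

noncomputable section

open scoped BigOperators

/-- The q-Pochhammer symbol `(a;q)_n = ∏_{j=0}^{n-1} (1 - a q^j)`. -/
def qPoch (q a : ℂ) (n : ℕ) : ℂ := ∏ j ∈ Finset.range n, (1 - a * q ^ j)

/-- The Gaussian (q-)binomial coefficient, characterized by
`qBinom q n 0 = 1`, `qBinom q 0 (k+1) = 0` and the Pascal-type rule
`qBinom q (n+1) (k+1) = q^(k+1) * qBinom q n (k+1) + qBinom q n k`. -/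
def qBinom (q : ℂ) : ℕ → ℕ → ℂ
  | _, 0 => 1
  | 0, _ + 1 => 0
  | n + 1, k + 1 => q ^ (k + 1) * qBinom q n (k + 1) + qBinom q n k

/-- The connection coefficients `c_{n,k}(a,b) = Σ_{ℓ=k}^{n} binom_q(n,ℓ)·binom_q(ℓ,k)·a^{n-ℓ}·b^{ℓ-k}`. -/
def cCoef (q a b : ℂ) (n k : ℕ) : ℂ :=
  ∑ ℓ ∈ Finset.Icc k n, qBinom q n ℓ * qBinom q ℓ k * a ^ (n - ℓ) * b ^ (ℓ - k)

/-- `A_n(a,b,c,d) = θ^n Σ_{k=0}^{n} c_{n,k}(a,b)·(ab;q)_k·a^{-k}·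
Σ_{j=0}^{k} q^j (q^{-k};q)_j (ad;q)_j (ac;q)_j / ((q;q)_j (abcd;q)_j)`. -/
def Acoef (q θ : ℂ) (n : ℕ) (a b c d : ℂ) : ℂ :=
  θ ^ n *
    ∑ k ∈ Finset.range (n + 1),
      cCoef q a b n k * qPoch q (a * b) k * a⁻¹ ^ k *
        ∑ j ∈ Finset.range (k + 1),
          q ^ j * qPoch q (q⁻¹ ^ k) j * qPoch q (a * d) j * qPoch q (a * c) j /
            (qPoch q q j * qPoch q (a * b * c * d) j)

open Finset in
theorem qPoch_succ (q a : ℂ) (n : ℕ) : qPoch q a (n + 1) = qPoch q a n * (1 - a * q ^ n) := by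
  simp [qPoch, prod_range_succ]

theorem qPoch_zero (q a : ℂ) : qPoch q a 0 = 1 := by
  simp [qPoch]

open Finset in
theorem qPoch_succ' (q a : ℂ) (n : ℕ) : qPoch q a (n + 1) = (1 - a) * qPoch q (a * q) n := by
  simp only [qPoch, prod_range_succ', pow_zero, mul_one]
  rw [mul_comm]
  congr 1
  refine prod_congr rfl fun j _ => ?_
  ring

open Finset in
theorem qPoch_ne_zero {q a : ℂ} {n : ℕ} (h : ∀ j < n, a * q ^ j ≠ 1) : qPoch q a n ≠ 0 := by
  refine prod_ne_zero_iff.2 fun j hj => ?_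
  exact sub_ne_zero.2 (h j (mem_range.1 hj)).symm

/-- The sequence `f` shifted by one place, with value `0` at `0`. -/
def prevSeq (f : ℕ → ℂ) : ℕ → ℂ
  | 0 => 0
  | k + 1 => f k

/-- The Cauchy product of two sequences. -/
def cauchyProd (f g : ℕ → ℂ) (n : ℕ) : ℂ := ∑ p ∈ Finset.HasAntidiagonal.antidiagonal n, f p.1 * g p.2

theorem cauchyProd_succ_left (f g : ℕ → ℂ) (n : ℕ) (hf : f 0 = 0) :
    cauchyProd f g (n + 1) = cauchyProd (fun k => f (k + 1)) g n := by
  simp [cauchyProd, Finset.Nat.sum_antidiagonal_succ, hf]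

theorem cauchyProd_succ_right (f g : ℕ → ℂ) (n : ℕ) (hg : g 0 = 0) :
    cauchyProd f g (n + 1) = cauchyProd f (fun k => g (k + 1)) n := by
  simp [cauchyProd, Finset.Nat.sum_antidiagonal_succ', hg]

theorem cauchyProd_shift (f g : ℕ → ℂ) (n : ℕ) (hf : f 0 = 0) (hg : g 0 = 0) :
    cauchyProd (fun k => f (k + 1)) g n = cauchyProd f (fun k => g (k + 1)) n := by
  rw [← cauchyProd_succ_left f g n hf, cauchyProd_succ_right f g n hg]

theorem cauchyProd_prevSeq_left (f g : ℕ → ℂ) (n : ℕ) :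
    cauchyProd (prevSeq f) g n = prevSeq (cauchyProd f g) n := by
  cases n with
  | zero => simp [cauchyProd, prevSeq]
  | succ n => rw [cauchyProd_succ_left _ _ _ rfl]; rfl

theorem cauchyProd_prevSeq_right (f g : ℕ → ℂ) (n : ℕ) :
    cauchyProd f (prevSeq g) n = prevSeq (cauchyProd f g) n := by
  cases n with
  | zero => simp [cauchyProd, prevSeq]
  | succ n => rw [cauchyProd_succ_right _ _ _ rfl]; rfl

/-- The polynomial `∏_{j<k} (s - p q^j)`. -/
def shiftedPow (q p s : ℂ) (k : ℕ) : ℂ := ∏ j ∈ Finset.range k, (s - p * q ^ j)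

theorem shiftedPow_succ (q p s : ℂ) (k : ℕ) :
    shiftedPow q p s (k + 1) = shiftedPow q p s k * (s - p * q ^ k) := by
  simp [shiftedPow, Finset.prod_range_succ]

theorem shiftedPow_q_mul_succ (q p s : ℂ) (k : ℕ) :
    shiftedPow q p (q * s) (k + 1) =
      q ^ (k + 1) * shiftedPow q p s (k + 1)
        - p * q ^ k * (1 - q ^ (k + 1)) * shiftedPow q p s k := by
  have key : shiftedPow q p (q * s) (k + 1) = (q * s - p) * q ^ k * shiftedPow q p s k := by
    induction k with
    | zero => simp [shiftedPow]
    | succ k ih => rw [shiftedPow_succ, ih, shiftedPow_succ]; ring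
  rw [key, shiftedPow_succ]
  ring

/-- Three-term recurrences for the factors of a Cauchy product yield the two-variable recurrence of
the product. -/
theorem cauchyProd_recurrence (q p e σ γ s : ℂ) (H r : ℕ → ℂ) (n : ℕ)
    (hH : ∀ i, (1 - q ^ (i + 1)) * H (i + 1) = σ * H i - p * prevSeq H i)
    (hr : ∀ k ≤ n, (1 - e * p * q ^ k) * (1 - q ^ (k + 1)) * r (k + 1) =
      (γ - σ * e * q ^ k) * r k - e * prevSeq r k)
    (F : ℂ → ℕ → ℂ)
    (hF : ∀ u, F u = cauchyProd (fun k => r k * shiftedPow q p u k) H) :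
    (1 - e * p * q ^ n) * (1 - q ^ (n + 1)) * F s (n + 1) =
      σ * (1 - s * e) * F (q * s) n + γ * (s - q ^ n * p) * F s n
        - (p * (1 - s * e) * prevSeq (F (q * s)) n
          + s * e * (s - p * q ^ n) * prevSeq (F s) n) := by
  set P := shiftedPow q p s with hP
  have hPs : ∀ k, P (k + 1) = P k * (s - p * q ^ k) := shiftedPow_succ q p s
  have lhs : (1 - q ^ (n + 1)) * F s (n + 1) =
      cauchyProd (fun k => q ^ k * (r k * P k)) (fun i => (1 - q ^ (i + 1)) * H (i + 1)) n +
      cauchyProd (fun k => (1 - q ^ (k + 1)) * (r (k + 1) * P (k + 1))) H n := by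
    rw [← cauchyProd_succ_right _ (fun i => (1 - q ^ i) * H i) n (by simp),
      ← cauchyProd_succ_left (fun k => (1 - q ^ k) * (r k * P k)) _ n (by simp), hF]
    simp only [cauchyProd, Finset.mul_sum, ← Finset.sum_add_distrib]
    refine Finset.sum_congr rfl fun x hx => ?_
    rw [← Finset.HasAntidiagonal.mem_antidiagonal.1 hx]
    ring
  have e1 : σ * F (q * s) n - p * prevSeq (F (q * s)) n =
      cauchyProd (fun k => r k * shiftedPow q p (q * s) k)
        (fun i => (1 - q ^ (i + 1)) * H (i + 1)) n := by
    rw [hF, ← cauchyProd_prevSeq_right]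
    simp only [cauchyProd, Finset.mul_sum, ← Finset.sum_sub_distrib]
    refine Finset.sum_congr rfl fun x _ => ?_
    rw [hH]
    ring
  have e2 : cauchyProd (fun k => r k * shiftedPow q p (q * s) k)
        (fun i => (1 - q ^ (i + 1)) * H (i + 1)) n =
      cauchyProd (fun k => q ^ k * (r k * P k)) (fun i => (1 - q ^ (i + 1)) * H (i + 1)) n
      - cauchyProd (fun k => p * q ^ k * (1 - q ^ (k + 1)) * r (k + 1) * P k)
        (fun i => (1 - q ^ i) * H i) n := by
    have := cauchyProd_shift (fun k => r k * prevSeq (fun k => p * q ^ k * (1 - q ^ (k + 1)) * P k) k)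
      (fun i => (1 - q ^ i) * H i) n (by simp [prevSeq]) (by simp)
    have h3 : cauchyProd (fun k => p * q ^ k * (1 - q ^ (k + 1)) * r (k + 1) * P k)
        (fun i => (1 - q ^ i) * H i) n = cauchyProd
        (fun k => r (k + 1) * prevSeq (fun k => p * q ^ k * (1 - q ^ (k + 1)) * P k) (k + 1))
        (fun i => (1 - q ^ i) * H i) n := by
      simp only [cauchyProd, prevSeq]
      refine Finset.sum_congr rfl fun x _ => ?_
      ring
    rw [h3, this]
    simp only [cauchyProd, ← Finset.sum_sub_distrib]
    refine Finset.sum_congr rfl fun x _ => ?_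
    rcases x with ⟨_ | k, i⟩
    · simp [prevSeq, hP, shiftedPow]
    · simp only [prevSeq, shiftedPow_q_mul_succ, hP]
      ring
  have e3 : γ * F s n - e * s * prevSeq (F s) n =
      cauchyProd (fun k => (1 - e * p * q ^ k) * (1 - q ^ (k + 1)) * r (k + 1) * P k) H n
      + e * cauchyProd (fun k => q ^ k * (r k * P k)) (fun i => (1 - q ^ (i + 1)) * H (i + 1)) n := by
    have a1 : s * prevSeq (F s) n = cauchyProd (fun k => prevSeq r k * P k) H n
        + p * cauchyProd (fun k => q ^ k * (r k * P k)) (prevSeq H) n := by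
      rw [cauchyProd_prevSeq_right, ← cauchyProd_prevSeq_left, hF, ← cauchyProd_prevSeq_left]
      simp only [cauchyProd, Finset.mul_sum, ← Finset.sum_add_distrib]
      refine Finset.sum_congr rfl fun x _ => ?_
      rcases x with ⟨_ | k, i⟩
      · simp [prevSeq]
      · simp only [prevSeq, hPs, ← hP]
        ring
    rw [mul_assoc, a1, hF]
    simp only [cauchyProd, Finset.mul_sum, ← Finset.sum_add_distrib, ← Finset.sum_sub_distrib]
    refine Finset.sum_congr rfl fun x hx => ?_
    have hx' := Finset.HasAntidiagonal.mem_antidiagonal.1 hx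
    rw [hr x.1 (by omega), hH]
    ring
  have comb : (1 - e * p * q ^ n) *
      (cauchyProd (fun k => q ^ k * (r k * P k)) (fun i => (1 - q ^ (i + 1)) * H (i + 1)) n +
      cauchyProd (fun k => (1 - q ^ (k + 1)) * (r (k + 1) * P (k + 1))) H n) =
      (1 - s * e) * (cauchyProd (fun k => q ^ k * (r k * P k))
        (fun i => (1 - q ^ (i + 1)) * H (i + 1)) n
      - cauchyProd (fun k => p * q ^ k * (1 - q ^ (k + 1)) * r (k + 1) * P k)
        (fun i => (1 - q ^ i) * H i) n)
      + (s - q ^ n * p) *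
        (cauchyProd (fun k => (1 - e * p * q ^ k) * (1 - q ^ (k + 1)) * r (k + 1) * P k) H n
      + e * cauchyProd (fun k => q ^ k * (r k * P k))
        (fun i => (1 - q ^ (i + 1)) * H (i + 1)) n) := by
    simp only [cauchyProd, Finset.mul_sum, ← Finset.sum_add_distrib, ← Finset.sum_sub_distrib]
    refine Finset.sum_congr rfl fun x hx => ?_
    rw [← Finset.HasAntidiagonal.mem_antidiagonal.1 hx, hPs]
    ring
  rw [mul_assoc, lhs, comb, ← e2, ← e1, ← e3]
  ring

/-- The `q`-hypergeometric weight `q^j (q^{-k};q)_j / (q;q)_j`. -/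
def qWeight (q : ℂ) (k j : ℕ) : ℂ := q ^ j * qPoch q (q⁻¹ ^ k) j / qPoch q q j

/-- The inner sum `Σ_j q^j (q^{-k};q)_j (x;q)_j (y;q)_j / ((q;q)_j (z;q)_j)`. -/
def innerSum (q x y z : ℂ) (k : ℕ) : ℂ :=
  ∑ j ∈ Finset.range (k + 1),
    q ^ j * qPoch q (q⁻¹ ^ k) j * qPoch q x j * qPoch q y j / (qPoch q q j * qPoch q z j)

theorem qPoch_self_ne_zero {q : ℂ} (hq' : ∀ j : ℕ, q ^ (j + 1) ≠ 1) (n : ℕ) : qPoch q q n ≠ 0 :=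
  qPoch_ne_zero fun j _ => by rw [← pow_succ']; exact hq' j

theorem qPoch_self_succ (q : ℂ) (n : ℕ) :
    qPoch q q (n + 1) = qPoch q q n * (1 - q ^ (n + 1)) := by
  rw [qPoch_succ, pow_succ']

theorem qWeight_zero_right (q : ℂ) (k : ℕ) : qWeight q k 0 = 1 := by
  simp [qWeight, qPoch]

theorem qWeight_succ_right {q : ℂ} (hq' : ∀ j : ℕ, q ^ (j + 1) ≠ 1) (k j : ℕ) :
    qWeight q k (j + 1) * (1 - q ^ (j + 1)) = q * qWeight q k j * (1 - q⁻¹ ^ k * q ^ j) := by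
  have h1 := qPoch_self_ne_zero hq' j
  have h2 : 1 - q ^ (j + 1) ≠ 0 := sub_ne_zero.2 (hq' j).symm
  simp only [qWeight, qPoch_self_succ]
  rw [qPoch_succ]
  generalize q⁻¹ ^ k = v
  field_simp
  ring

theorem qWeight_eq_zero {q : ℂ} (hq : q ≠ 0) {k j : ℕ} (h : k < j) : qWeight q k j = 0 := by
  have : qPoch q (q⁻¹ ^ k) j = 0 :=
    Finset.prod_eq_zero (Finset.mem_range.2 h) (by simp [hq])
  rw [qWeight, this, mul_zero, zero_div]

theorem qWeight_succ_succ {q : ℂ} (hq : q ≠ 0) (hq' : ∀ j : ℕ, q ^ (j + 1) ≠ 1) (k j : ℕ) :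
    qWeight q (k + 1) (j + 1) * (1 - q ^ (j + 1)) = q * (1 - q⁻¹ ^ (k + 1)) * qWeight q k j := by
  have h1 := qPoch_self_ne_zero hq' j
  have h2 : 1 - q ^ (j + 1) ≠ 0 := sub_ne_zero.2 (hq' j).symm
  have h3 : q⁻¹ ^ (k + 1) * q = q⁻¹ ^ k := by rw [pow_succ, mul_assoc, inv_mul_cancel₀ hq, mul_one]
  simp only [qWeight, qPoch_self_succ]
  rw [qPoch_succ', h3]
  generalize q⁻¹ ^ k = v
  generalize q⁻¹ ^ (k + 1) = v'
  field_simp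
  ring

theorem qWeight_succ_left {q : ℂ} (hq : q ≠ 0) (k j : ℕ) :
    (1 - q ^ (k + 1)) * qWeight q k j = (q ^ j - q ^ (k + 1)) * qWeight q (k + 1) j := by
  have h3 : q⁻¹ ^ (k + 1) * q = q⁻¹ ^ k := by rw [pow_succ, mul_assoc, inv_mul_cancel₀ hq, mul_one]
  have h4 := (qPoch_succ q (q⁻¹ ^ (k + 1)) j).symm.trans (qPoch_succ' q (q⁻¹ ^ (k + 1)) j)
  rw [h3] at h4
  have h5 : q ^ (k + 1) * q⁻¹ ^ (k + 1) = 1 := by simp [hq]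
  have h6 : (1 - q ^ (k + 1)) * qPoch q (q⁻¹ ^ k) j =
      (q ^ j - q ^ (k + 1)) * qPoch q (q⁻¹ ^ (k + 1)) j := by
    linear_combination (-qPoch q (q⁻¹ ^ k) j + q ^ j * qPoch q (q⁻¹ ^ (k + 1)) j) * h5
      + q ^ (k + 1) * h4
  simp only [qWeight]
  linear_combination q ^ j / qPoch q q j * h6

theorem qWeight_pascal {q : ℂ} (hq : q ≠ 0) (hq' : ∀ j : ℕ, q ^ (j + 1) ≠ 1) (k j : ℕ) :
    qWeight q (k + 1) (j + 1) * q ^ (j + 1) = qWeight q k (j + 1) - q * qWeight q k j := by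
  have h2 : 1 - q ^ (j + 1) ≠ 0 := sub_ne_zero.2 (hq' j).symm
  have hA := qWeight_succ_right hq' k j
  have hD := qWeight_succ_succ hq hq' k j
  have h5 : q * q⁻¹ = 1 := mul_inv_cancel₀ hq
  refine mul_right_cancel₀ h2 ?_
  rw [pow_succ q⁻¹ k] at hD
  linear_combination q ^ (j + 1) * hD - hA - q ^ (j + 1) * q⁻¹ ^ k * qWeight q k j * h5

theorem qWeight_pascal' {q : ℂ} (hq : q ≠ 0) (hq' : ∀ j : ℕ, q ^ (j + 1) ≠ 1) (k j : ℕ) :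
    q ^ k * (qWeight q (k + 1) (j + 1) - qWeight q k (j + 1)) = - qWeight q k j := by
  have h2 : 1 - q ^ (j + 1) ≠ 0 := sub_ne_zero.2 (hq' j).symm
  have hA := qWeight_succ_right hq' k j
  have hD := qWeight_succ_succ hq hq' k j
  have h5 : q * q⁻¹ = 1 := mul_inv_cancel₀ hq
  have h6 : q ^ k * q⁻¹ ^ k = 1 := by simp [hq]
  refine mul_right_cancel₀ h2 ?_
  rw [pow_succ q⁻¹ k] at hD
  linear_combination q ^ k * hD - q ^ k * hA - qWeight q k j * (q ^ k * q⁻¹ ^ k) * h5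
    + qWeight q k j * (q ^ (j + 1) - 1) * h6

theorem innerSum_eq {q : ℂ} (hq : q ≠ 0) (x y z : ℂ) {k m : ℕ} (h : k < m) :
    innerSum q x y z k =
      ∑ j ∈ Finset.range m, qWeight q k j * (qPoch q x j * qPoch q y j / qPoch q z j) := by
  rw [← Finset.sum_subset (Finset.range_mono (Nat.succ_le_of_lt h))]
  · refine Finset.sum_congr rfl fun j _ => ?_
    simp only [qWeight, div_eq_mul_inv, mul_inv]
    ring
  · intro j _ hj
    rw [qWeight_eq_zero hq (by simpa using hj), zero_mul]

/-- The contiguous relation of the terminating series `innerSum` in its degree. -/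
theorem innerSum_recurrence {q : ℂ} (hq : q ≠ 0) (hq' : ∀ j : ℕ, q ^ (j + 1) ≠ 1) (x y z : ℂ)
    (k : ℕ) (hz : ∀ j ≤ k, z * q ^ j ≠ 1) :
    (1 - z * q ^ k) * innerSum q x y z (k + 1) =
      (x + y - (x * y + z) * q ^ k) * innerSum q x y z k
        - x * y * (1 - q ^ k) * prevSeq (innerSum q x y z) k := by
  set w : ℕ → ℂ := fun j => qPoch q x j * qPoch q y j / qPoch q z j with hw
  have hprev : (1 - q ^ k) * prevSeq (innerSum q x y z) k =
      ∑ j ∈ Finset.range (k + 2), (q ^ j - q ^ k) * qWeight q k j * w j := by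
    cases k with
    | zero =>
      simp [Finset.sum_range_succ, qWeight_eq_zero hq (show 0 < 1 by norm_num)]
    | succ k =>
      simp only [prevSeq]
      rw [innerSum_eq hq x y z (show k < k + 1 + 2 by omega), Finset.mul_sum]
      refine Finset.sum_congr rfl fun j _ => ?_
      rw [← mul_assoc, qWeight_succ_left hq]
  have hstep : ∀ j ≤ k, (1 - z * q ^ j) * w (j + 1) = (1 - x * q ^ j) * (1 - y * q ^ j) * w j := by
    intro j hj
    have h1 : 1 - z * q ^ j ≠ 0 := sub_ne_zero.2 (hz j hj).symm
    have h2 : qPoch q z j ≠ 0 := qPoch_ne_zero fun i hi => hz i (by omega)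
    simp only [hw]
    rw [qPoch_succ, qPoch_succ, qPoch_succ]
    field_simp
  have hsum : (x + y) * innerSum q x y z k =
      ∑ j ∈ Finset.range (k + 2), (x * y * q ^ j + q⁻¹ ^ j) * qWeight q k j * w j
      - ∑ j ∈ Finset.range (k + 1), (q⁻¹ ^ j - z) * qWeight q k j * w (j + 1) := by
    rw [Finset.sum_range_succ _ (k + 1), qWeight_eq_zero hq (Nat.lt_succ_self k),
      innerSum_eq hq x y z (Nat.lt_succ_self k), Finset.mul_sum]
    simp only [mul_zero, zero_mul, add_zero, ← Finset.sum_sub_distrib]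
    refine Finset.sum_congr rfl fun j hj => ?_
    have h6 : q ^ j * q⁻¹ ^ j = 1 := by simp [hq]
    have h7 := hstep j (Nat.lt_succ_iff.1 (Finset.mem_range.1 hj))
    change (x + y) * (qWeight q k j * w j) = _
    linear_combination qWeight q k j * q⁻¹ ^ j * h7 +
      qWeight q k j * (z * w (j + 1) - (x + y) * w j + x * y * q ^ j * w j) * h6
  have hmain : (1 - z * q ^ k) * innerSum q x y z (k + 1) + z * q ^ k * innerSum q x y z k =
      ∑ j ∈ Finset.range (k + 2), q⁻¹ ^ j * qWeight q k j * w j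
      - ∑ j ∈ Finset.range (k + 1), (q⁻¹ ^ j - z) * qWeight q k j * w (j + 1) := by
    rw [innerSum_eq hq x y z (Nat.lt_succ_self (k + 1)),
      innerSum_eq hq x y z (show k < k + 1 + 1 by omega), Finset.sum_range_succ',
      Finset.sum_range_succ' _ (k + 1), Finset.sum_range_succ' _ (k + 1)]
    simp only [qWeight_zero_right, mul_add, Finset.mul_sum]
    rw [add_sub_right_comm, ← Finset.sum_sub_distrib, add_add_add_comm, ← Finset.sum_add_distrib]
    congr 1
    · refine Finset.sum_congr rfl fun j _ => ?_
      change (1 - z * q ^ k) * (qWeight q (k + 1) (j + 1) * w (j + 1))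
        + z * q ^ k * (qWeight q k (j + 1) * w (j + 1)) = _
      have h6 : q ^ (j + 1) * q⁻¹ ^ (j + 1) = 1 := by simp [hq]
      have h8 : q * q⁻¹ ^ (j + 1) = q⁻¹ ^ j := by
        rw [pow_succ', ← mul_assoc, mul_inv_cancel₀ hq, one_mul]
      have h9 := qWeight_pascal hq hq' k j
      have h10 := qWeight_pascal' hq hq' k j
      linear_combination -z * w (j + 1) * h10 + w (j + 1) * q⁻¹ ^ (j + 1) * h9
        - w (j + 1) * qWeight q (k + 1) (j + 1) * h6 - w (j + 1) * qWeight q k j * h8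
    · simp only [pow_zero]
      change (1 - z * q ^ k) * (1 * w 0) + z * q ^ k * (1 * w 0) = 1 * 1 * w 0
      ring
  have hsplit : ∑ j ∈ Finset.range (k + 2), (x * y * q ^ j + q⁻¹ ^ j) * qWeight q k j * w j =
      ∑ j ∈ Finset.range (k + 2), q⁻¹ ^ j * qWeight q k j * w j
      + x * y * ∑ j ∈ Finset.range (k + 2), (q ^ j - q ^ k) * qWeight q k j * w j
      + x * y * q ^ k * innerSum q x y z k := by
    rw [innerSum_eq hq x y z (show k < k + 2 by omega)]
    simp only [Finset.mul_sum, ← Finset.sum_add_distrib]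
    refine Finset.sum_congr rfl fun j _ => ?_
    change _ = _ + _ + x * y * q ^ k * (qWeight q k j * w j)
    ring
  linear_combination hmain - hsum - hsplit + x * y * hprev

theorem qBinom_zero_right (q : ℂ) (n : ℕ) : qBinom q n 0 = 1 := by
  cases n <;> rfl

theorem qBinom_eq_zero (q : ℂ) {n k : ℕ} (h : n < k) : qBinom q n k = 0 := by
  induction n generalizing k with
  | zero =>
    obtain ⟨k, rfl⟩ := Nat.exists_eq_succ_of_ne_zero h.ne'
    rfl
  | succ n ih =>
    obtain ⟨k, rfl⟩ := Nat.exists_eq_succ_of_ne_zero (Nat.ne_zero_of_lt h)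
    rw [Nat.succ_eq_add_one, qBinom, ih (by omega), ih (by omega)]
    ring

theorem qBinom_mul_qPoch (q : ℂ) (k i : ℕ) :
    qBinom q (k + i) k * (qPoch q q k * qPoch q q i) = qPoch q q (k + i) := by
  induction k generalizing i with
  | zero => simp [qBinom_zero_right, qPoch_zero]
  | succ k ih =>
    induction i with
    | zero =>
      have h := ih 0
      simp only [qPoch_zero, add_zero, mul_one] at h ⊢
      rw [qBinom, qBinom_eq_zero q (Nat.lt_succ_self k), qPoch_self_succ]
      linear_combination (1 - q ^ (k + 1)) * h
    | succ i ih' =>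
      have h := ih (i + 1)
      rw [show k + 1 + (i + 1) = k + 1 + i + 1 by ring, qBinom]
      rw [show k + (i + 1) = k + 1 + i by ring] at h
      rw [qPoch_self_succ q (k + 1 + i), qPoch_self_succ q k, qPoch_self_succ q i] at *
      have e : q ^ (k + 1 + i + 1) = q ^ (k + 1) * q ^ (i + 1) := by ring
      linear_combination (1 - q ^ (k + 1)) * h + q ^ (k + 1) * (1 - q ^ (i + 1)) * ih'
        + qPoch q q (k + 1 + i) * e

/-- Homogeneous Rogers–Szegő polynomials divided by `(q;q)_n`. -/
def rogersSzego (q a b : ℂ) : ℕ → ℂ :=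
  cauchyProd (fun i => b ^ i / qPoch q q i) (fun i => a ^ i / qPoch q q i)

theorem rogersSzego_recurrence {q : ℂ} (hq' : ∀ j : ℕ, q ^ (j + 1) ≠ 1) (a b : ℂ) (i : ℕ) :
    (1 - q ^ (i + 1)) * rogersSzego q a b (i + 1) =
      (a + b) * rogersSzego q a b i - a * b * prevSeq (rogersSzego q a b) i := by
  set f : ℂ → ℕ → ℂ := fun c i => c ^ i / qPoch q q i with hf
  have hfs : ∀ c j, (1 - q ^ (j + 1)) * f c (j + 1) = c * f c j := by
    intro c j
    have h1 := qPoch_self_ne_zero hq' j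
    have h2 : 1 - q ^ (j + 1) ≠ 0 := sub_ne_zero.2 (hq' j).symm
    simp only [hf, qPoch_self_succ]
    field_simp
    ring
  have hprev : ∀ c j, q ^ j * f c j = f c j - c * prevSeq (f c) j := by
    intro c j
    cases j with
    | zero => simp [prevSeq]
    | succ j =>
      simp only [prevSeq]
      linear_combination -hfs c j
  have h1 : (1 - q ^ (i + 1)) * rogersSzego q a b (i + 1) =
      cauchyProd (fun k => q ^ k * f b k) (fun j => (1 - q ^ (j + 1)) * f a (j + 1)) i +
      cauchyProd (fun k => (1 - q ^ (k + 1)) * f b (k + 1)) (f a) i := by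
    rw [← cauchyProd_succ_right _ (fun j => (1 - q ^ j) * f a j) i (by simp),
      ← cauchyProd_succ_left (fun k => (1 - q ^ k) * f b k) _ i (by simp), rogersSzego]
    simp only [cauchyProd, Finset.mul_sum, ← Finset.sum_add_distrib]
    refine Finset.sum_congr rfl fun x hx => ?_
    rw [← Finset.HasAntidiagonal.mem_antidiagonal.1 hx]
    change (1 - q ^ (x.1 + x.2)) * (f b x.1 * f a x.2) = _
    ring
  rw [h1, show rogersSzego q a b = cauchyProd (f b) (f a) from rfl, ← cauchyProd_prevSeq_left]
  simp only [hfs, hprev, cauchyProd, Finset.mul_sum, ← Finset.sum_add_distrib,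
    ← Finset.sum_sub_distrib]
  refine Finset.sum_congr rfl fun x _ => ?_
  ring

theorem cCoef_eq {q : ℂ} (hq' : ∀ j : ℕ, q ^ (j + 1) ≠ 1) (a b : ℂ) (k i : ℕ) :
    cCoef q a b (k + i) k = qPoch q q (k + i) / qPoch q q k * rogersSzego q a b i := by
  have hQ := qPoch_self_ne_zero hq'
  rw [cCoef, ← Finset.Ico_add_one_right_eq_Icc, Finset.sum_Ico_eq_sum_range, rogersSzego, cauchyProd,
    Finset.Nat.sum_antidiagonal_eq_sum_range_succ_mk, Finset.mul_sum,
    show k + i + 1 - k = i + 1 by omega]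
  refine Finset.sum_congr rfl fun l hl => ?_
  obtain ⟨m, rfl⟩ := Nat.exists_eq_add_of_le (Nat.lt_succ_iff.1 (Finset.mem_range.1 hl))
  have h1 := qBinom_mul_qPoch q k l
  have h2 := qBinom_mul_qPoch q (k + l) m
  rw [show k + (l + m) - (k + l) = m by omega, show k + l - k = l by omega,
    show l + m - l = m by omega, ← add_assoc, ← h2, ← h1]
  have := hQ k
  have := hQ l
  have := hQ m
  field_simp

/-- The normalized coefficients `a^{-k} innerSum_k / (q;q)_k`. -/
def innerCoef (q a x y z : ℂ) (k : ℕ) : ℂ := a⁻¹ ^ k * innerSum q x y z k / qPoch q q k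

theorem innerCoef_recurrence {q : ℂ} (hq : q ≠ 0) (hq' : ∀ j : ℕ, q ^ (j + 1) ≠ 1) {a : ℂ}
    (ha : a ≠ 0) (b c d : ℂ) (k : ℕ) (hz : ∀ j ≤ k, a * b * c * d * q ^ j ≠ 1) :
    (1 - c * d * (a * b) * q ^ k) * (1 - q ^ (k + 1)) *
        innerCoef q a (a * d) (a * c) (a * b * c * d) (k + 1) =
      (c + d - (a + b) * (c * d) * q ^ k) * innerCoef q a (a * d) (a * c) (a * b * c * d) k
        - c * d * prevSeq (innerCoef q a (a * d) (a * c) (a * b * c * d)) k := by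
  have hQ := qPoch_self_ne_zero hq'
  have hQ1 : ∀ j, 1 - q ^ (j + 1) ≠ 0 := fun j => sub_ne_zero.2 (hq' j).symm
  have h := innerSum_recurrence hq hq' (a * d) (a * c) (a * b * c * d) k hz
  set S := innerSum q (a * d) (a * c) (a * b * c * d) with hS
  have hprev : (1 - q ^ k) * prevSeq S k * a⁻¹ ^ k * a =
      prevSeq (innerCoef q a (a * d) (a * c) (a * b * c * d)) k * qPoch q q k := by
    cases k with
    | zero => simp [prevSeq]
    | succ k =>
      have := hQ k
      have := hQ1 k
      have e : a⁻¹ ^ (k + 1) * a = a⁻¹ ^ k := by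
        rw [pow_succ, mul_assoc, inv_mul_cancel₀ ha, mul_one]
      simp only [prevSeq, innerCoef, ← hS, qPoch_self_succ]
      rw [mul_assoc, e]
      generalize a⁻¹ ^ k = v
      field_simp
  have hk1 : (1 - q ^ (k + 1)) * innerCoef q a (a * d) (a * c) (a * b * c * d) (k + 1) *
      qPoch q q k * a = a⁻¹ ^ k * S (k + 1) := by
    have := hQ k
    have := hQ1 k
    simp only [innerCoef, ← hS, qPoch_self_succ, pow_succ a⁻¹]
    generalize a⁻¹ ^ k = v
    field_simp
  have hk : innerCoef q a (a * d) (a * c) (a * b * c * d) k * qPoch q q k = a⁻¹ ^ k * S k := by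
    have := hQ k
    simp only [innerCoef, ← hS]
    field_simp
  refine mul_right_cancel₀ (mul_ne_zero (hQ k) ha) ?_
  linear_combination (1 - c * d * (a * b) * q ^ k) * hk1
    - a * (c + d - (a + b) * (c * d) * q ^ k) * hk + a⁻¹ ^ k * h - c * d * a * hprev

theorem shiftedPow_one_div_sq (q p : ℂ) {t : ℂ} (ht : t ≠ 0) (k : ℕ) :
    qPoch q (p * t ^ 2) k = (t ^ 2) ^ k * shiftedPow q p (1 / t ^ 2) k := by
  induction k with
  | zero => simp [qPoch, shiftedPow]
  | succ k ih =>
    rw [qPoch_succ, ih, shiftedPow_succ, pow_succ (t ^ 2)]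
    field_simp

theorem rogersSzego_mul (q a b t : ℂ) (i : ℕ) :
    rogersSzego q (a * t) (b * t) i = t ^ i * rogersSzego q a b i := by
  simp only [rogersSzego, cauchyProd, Finset.mul_sum]
  refine Finset.sum_congr rfl fun x hx => ?_
  rw [← Finset.HasAntidiagonal.mem_antidiagonal.1 hx]
  ring

theorem Acoef_eq {q : ℂ} (hq' : ∀ j : ℕ, q ^ (j + 1) ≠ 1) (θ a b c d : ℂ) {t : ℂ} (ht : t ≠ 0)
    (n : ℕ) :
    Acoef q θ n (a * t) (b * t) (c / t) (d / t) =
      t ^ n * (θ ^ n * qPoch q q n *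
        cauchyProd (fun k => innerCoef q a (a * d) (a * c) (a * b * c * d) k *
          shiftedPow q (a * b) (1 / t ^ 2) k) (rogersSzego q a b) n) := by
  rw [Acoef, cauchyProd, Finset.Nat.sum_antidiagonal_eq_sum_range_succ_mk]
  rw [Finset.mul_sum _ _ (θ ^ n), ← mul_assoc (t ^ n), Finset.mul_sum _ _ (t ^ n * _)]
  refine Finset.sum_congr rfl fun k hk => ?_
  obtain ⟨i, rfl⟩ := Nat.exists_eq_add_of_le (Nat.lt_succ_iff.1 (Finset.mem_range.1 hk))
  have e1 : a * t * (b * t) = a * b * t ^ 2 := by ring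
  have e2 : a * t * (d / t) = a * d := by field_simp
  have e3 : a * t * (c / t) = a * c := by field_simp
  have e4 : a * b * t ^ 2 * (c / t) * (d / t) = a * b * c * d := by field_simp
  rw [e1, e2, e3, e4, cCoef_eq hq', rogersSzego_mul, shiftedPow_one_div_sq q _ ht, innerCoef,
    ← innerSum, show k + i - k = i by omega, mul_inv, mul_pow]
  have e5 : t⁻¹ ^ k * (t ^ 2) ^ k = t ^ k := by
    rw [← mul_pow]
    congr 1
    field_simp
  linear_combination (θ ^ (k + i) * (qPoch q q (k + i) / qPoch q q k) * t ^ i * rogersSzego q a b i *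
    shiftedPow q (a * b) (1 / t ^ 2) k * a⁻¹ ^ k * innerSum q (a * d) (a * c) (a * b * c * d) k) * e5

theorem stmt19 (q : ℝ) (hq0 : 0 < q) (hq1 : q < 1) (N : ℕ)
    (a c : ℝ) (ha : 0 < a) (hc : 0 < c) (b d : ℂ)
    (hsing : ∀ j : ℕ, j < N → (a : ℂ) * b * (c : ℂ) * d * (q : ℂ) ^ j ≠ 1)
    (θ : ℂ) (hθ : θ = ((1 / Real.sqrt (1 - q) : ℝ) : ℂ))
    (G : ℕ → ℂ → ℂ)
    (hG0 : ∀ t : ℂ, G 0 t = 1)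
    (hGrec : ∀ n : ℕ, n < N → ∀ t : ℂ,
      (1 - (a : ℂ) * b * (c : ℂ) * d * (q : ℂ) ^ n) * G (n + 1) t =
        θ * ((a + b) * (1 - t * (c : ℂ) * d) * G n ((q : ℂ) * t)
              + ((c : ℂ) + d) * (t - (q : ℂ) ^ n * (a : ℂ) * b) * G n t)
          - θ ^ 2 * (1 - (q : ℂ) ^ n) *
              ((a : ℂ) * b * (1 - t * (c : ℂ) * d) * G (n - 1) ((q : ℂ) * t)
                + t * (c : ℂ) * d * (t - (a : ℂ) * b * (q : ℂ) ^ n) * G (n - 1) t)) :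
    ∀ n : ℕ, n < N → ∀ t : ℂ, t ≠ 0 →
      t ^ n * G n (1 / t ^ 2) =
        Acoef (q : ℂ) θ n ((a : ℂ) * t) (b * t) ((c : ℂ) / t) (d / t) := by
  set Q : ℂ := (q : ℂ) with hQdef
  have hq : Q ≠ 0 := Complex.ofReal_ne_zero.2 hq0.ne'
  have hq' : ∀ j : ℕ, Q ^ (j + 1) ≠ 1 := by
    intro j
    have := pow_lt_one₀ hq0.le hq1 (Nat.succ_ne_zero j)
    rw [hQdef]
    exact_mod_cast this.ne
  have ha' : (a : ℂ) ≠ 0 := by exact_mod_cast ha.ne'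
  set F : ℂ → ℕ → ℂ := fun u => cauchyProd
    (fun k => innerCoef Q a (a * d) (a * c) (a * b * c * d) k * shiftedPow Q (a * b) u k)
    (rogersSzego Q a b) with hF
  have key : ∀ n < N, ∀ s, G n s = θ ^ n * qPoch Q Q n * F s n := by
    intro n
    induction n using Nat.strong_induction_on with
    | _ n ih =>
      intro hn s
      cases n with
      | zero =>
        simp [hG0, hF, cauchyProd, rogersSzego, qPoch, shiftedPow, innerCoef, innerSum]
      | succ n =>
        have hnN : n < N := by omega
        have hrec := cauchyProd_recurrence Q (a * b) (c * d) (a + b) (c + d) s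
          (rogersSzego Q a b) (innerCoef Q a (a * d) (a * c) (a * b * c * d)) n
          (rogersSzego_recurrence hq' a b)
          (fun k hk => innerCoef_recurrence hq hq' ha' b c d k
            fun j hj => hsing j (by omega)) F (fun _ => rfl)
        have hprev : ∀ u, θ * (1 - Q ^ n) * G (n - 1) u =
            θ ^ n * qPoch Q Q n * prevSeq (F u) n := by
          intro u
          cases n with
          | zero => simp [prevSeq]
          | succ m =>
            rw [Nat.add_sub_cancel, ih m (by omega) (by omega), qPoch_self_succ, prevSeq]
            ring
        have hg := hGrec n hnN s
        rw [ih n (by omega) hnN, ih n (by omega) hnN] at hg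
        refine mul_left_cancel₀ (sub_ne_zero.2 (hsing n hnN).symm) (hg.trans ?_)
        rw [qPoch_self_succ]
        linear_combination -θ ^ (n + 1) * qPoch Q Q n * hrec
          - θ * (a * b * (1 - s * c * d)) * hprev (Q * s)
          - θ * (s * c * d * (s - a * b * Q ^ n)) * hprev s
  intro n hn t ht
  rw [key n hn, Acoef_eq hq' θ a b c d ht]

end
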